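/- arXiv:1110.6187 — 3 statements merged into one kernel-verified Lean document; each statement's English description precedes it below -/
import Mathlib

section
/- (Measurable selection in a possibly non-separable Banach space.) Let (Ω, 𝒜, P) be a complete probability space and E a real Banach space. Let F : Ω → ℭ(E) be strongly measurable, i.e., there exists a sequence of countably-valued maps G_n : Ω → ℭ(E) with ess sup_{ω∈Ω} h(G_n(ω), F(ω)) → 0 as n → ∞, and suppose ∫_Ω ‖F(ω)‖ dP < ∞ where ‖F(ω)‖ = sup{‖x‖ : x ∈ F(ω)}. Then there exists a measurable map f : Ω → E (i.e., f is the uniform a.s. limit of countably-valued maps Ω → E) such that f(ω) ∈ F(ω) for almost every ω ∈ Ω; in particular f is Bochner integrable. -/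
open Metric Filter Topology MeasureTheory

variable {Ω : Type*} [MeasurableSpace Ω]
variable {E : Type*} [NormedAddCommGroup E] [NormedSpace ℝ E] [CompleteSpace E]

/-- The excess `e(A,B) = sup_{a ∈ A} d(a, B)`. -/
noncomputable def excess (A B : Set E) : ℝ := sSup ((fun a => infDist a B) '' A)

/-- The Pompeiu–Hausdorff distance `h(A,B) = max (e(A,B)) (e(B,A))`. -/
noncomputable def hdist (A B : Set E) : ℝ := max (excess A B) (excess B A)

/-- Membership in `ℭ(E)`: nonempty, closed and bounded. -/
def IsCB (A : Set E) : Prop := A.Nonempty ∧ IsClosed A ∧ Bornology.IsBounded A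

/-- A map is countably-valued if it is constant on each piece of a countable measurable
partition of `Ω`. -/
def CountablyValued {α : Type*} (g : Ω → α) : Prop :=
  ∃ (P : ℕ → Set Ω) (a : ℕ → α),
    (∀ i, MeasurableSet (P i)) ∧ Pairwise (Function.onFun Disjoint P) ∧
    (⋃ i, P i) = Set.univ ∧ ∀ i, ∀ ω ∈ P i, g ω = a i

/-- A set-valued map `F : Ω → ℭ(E)` is strongly measurable if some sequence of
countably-valued maps with values in `ℭ(E)` converges to it uniformly almost surely in
the Pompeiu–Hausdorff metric (i.e. `ess sup_ω h(Gₙ(ω), F(ω)) → 0`). -/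
def SMeasurableSet (μ : Measure Ω) (F : Ω → Set E) : Prop :=
  ∃ G : ℕ → Ω → Set E,
    (∀ n, CountablyValued (G n)) ∧ (∀ n ω, IsCB (G n ω)) ∧
    ∀ ε : ℝ, 0 < ε → ∃ N : ℕ, ∀ n ≥ N, ∀ᵐ ω ∂μ, hdist (G n ω) (F ω) ≤ ε

/-- A single-valued map `f : Ω → E` is measurable (in the sense of Hille–Phillips) if
some sequence of countably-valued maps converges to it uniformly almost surely. -/
def PMeasurable (μ : Measure Ω) (f : Ω → E) : Prop :=
  ∃ g : ℕ → Ω → E, (∀ n, CountablyValued (g n)) ∧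
    ∀ ε : ℝ, 0 < ε → ∃ N : ℕ, ∀ n ≥ N, ∀ᵐ ω ∂μ, ‖g n ω - f ω‖ ≤ ε

lemma infDist_le_excess {V : Type*} [NormedAddCommGroup V] {A : Set V} (hA : IsCB A) (B : Set V)
    {a : V} (ha : a ∈ A) :
    infDist a B ≤ excess A B :=
  le_csSup ((lipschitz_infDist_pt B).isBounded_image hA.2.2).bddAbove ⟨a, ha, rfl⟩

lemma infDist_le_infDist_add_excess {V : Type*} [NormedAddCommGroup V] {A : Set V} (hA : IsCB A)
    (B : Set V) (x : V) :
    infDist x B ≤ infDist x A + excess A B := by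
  refine le_of_forall_pos_le_add fun ε hε => ?_
  obtain ⟨a, ha, hxa⟩ := (infDist_lt_iff hA.1).1 (lt_add_of_pos_right (infDist x A) hε)
  have h := infDist_le_infDist_add_dist (s := B) (x := x) (y := a)
  linarith [infDist_le_excess hA B ha]

/-- A point of `A` whose distance to `x` is within `δ` of `infDist x A`, when there is one. -/
noncomputable def nearPoint {X : Type*} [PseudoMetricSpace X] (δ : ℝ) (x : X) (A : Set X) : X :=
  open Classical in
  if h : ∃ a ∈ A, dist x a < infDist x A + δ then h.choose else x

lemma nearPoint_spec {X : Type*} [PseudoMetricSpace X] {δ : ℝ} (hδ : 0 < δ) (x : X) {A : Set X}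
    (hA : A.Nonempty) :
    nearPoint δ x A ∈ A ∧ dist x (nearPoint δ x A) < infDist x A + δ := by
  have h : ∃ a ∈ A, dist x a < infDist x A + δ :=
    (infDist_lt_iff hA).1 (lt_add_of_pos_right _ hδ)
  rw [nearPoint, dif_pos h]
  exact h.choose_spec

namespace CountablyValued

lemma const {α : Type*} (c : α) : CountablyValued (fun _ : Ω => c) := by
  refine ⟨fun i => {_ω | i = 0}, fun _ => c, fun i => MeasurableSet.const _, ?_, ?_, ?_⟩
  · intro i j hij
    refine Set.disjoint_left.2 fun ω hi hj => hij ?_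
    exact Eq.trans (b := 0) hi (Eq.symm hj)
  · exact Set.eq_univ_of_forall fun ω => Set.mem_iUnion.2 ⟨0, rfl⟩
  · exact fun _ _ _ => rfl

lemma map₂ {α β γ : Type*} {f : Ω → α} {g : Ω → β} (hf : CountablyValued f)
    (hg : CountablyValued g) (u : α → β → γ) : CountablyValued (fun ω => u (f ω) (g ω)) := by
  obtain ⟨P, a, hPm, hPd, hPu, hPa⟩ := hf
  obtain ⟨Q, b, hQm, hQd, hQu, hQb⟩ := hg
  refine ⟨fun n => P n.unpair.1 ∩ Q n.unpair.2, fun n => u (a n.unpair.1) (b n.unpair.2),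
    fun n => (hPm _).inter (hQm _), ?_, ?_, ?_⟩
  · intro m n hmn
    refine Set.disjoint_left.2 fun ω hm hn => hmn ?_
    have h1 : m.unpair.1 = n.unpair.1 := by
      by_contra h
      exact Set.disjoint_left.1 (hPd h) hm.1 hn.1
    have h2 : m.unpair.2 = n.unpair.2 := by
      by_contra h
      exact Set.disjoint_left.1 (hQd h) hm.2 hn.2
    rw [← Nat.pair_unpair m, ← Nat.pair_unpair n, h1, h2]
  · refine Set.eq_univ_of_forall fun ω => ?_
    obtain ⟨i, hi⟩ := Set.mem_iUnion.1 (hPu ▸ Set.mem_univ ω)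
    obtain ⟨j, hj⟩ := Set.mem_iUnion.1 (hQu ▸ Set.mem_univ ω)
    exact Set.mem_iUnion.2 ⟨Nat.pair i j, by simpa using ⟨hi, hj⟩⟩
  · rintro n ω ⟨hP, hQ⟩
    simp only [hPa _ ω hP, hQb _ ω hQ]

lemma stronglyMeasurable {X : Type*} [TopologicalSpace X] [TopologicalSpace.PseudoMetrizableSpace X]
    {f : Ω → X} (hf : CountablyValued f) : StronglyMeasurable f := by
  borelize X
  obtain ⟨P, a, hPm, -, hPu, hPa⟩ := hf
  have hcov (ω : Ω) : ∃ i, ω ∈ P i := Set.mem_iUnion.1 (hPu ▸ Set.mem_univ ω)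
  refine stronglyMeasurable_iff_measurable_separable.2 ⟨fun s _ => ?_, ?_⟩
  · have h : f ⁻¹' s = ⋃ i ∈ {i | a i ∈ s}, P i := by
      ext ω
      simp only [Set.mem_preimage, Set.mem_iUnion, Set.mem_ofPred_eq, exists_prop]
      constructor
      · intro hω
        obtain ⟨i, hi⟩ := hcov ω
        exact ⟨i, hPa i ω hi ▸ hω, hi⟩
      · rintro ⟨i, his, hi⟩
        rwa [hPa i ω hi]
    rw [h]
    exact MeasurableSet.biUnion (Set.to_countable _) fun i _ => hPm i
  · refine ((Set.countable_range a).mono ?_).isSeparable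
    rintro _ ⟨ω, rfl⟩
    obtain ⟨i, hi⟩ := hcov ω
    exact ⟨i, (hPa i ω hi).symm⟩

end CountablyValued

/-- Successive near-points: `nearSeq G (n + 1) ω` is a point of `G (n + 1) ω` almost nearest to
`nearSeq G n ω`. -/
noncomputable def nearSeq {ι : Type*} {V : Type*} [NormedAddCommGroup V] (G : ℕ → ι → Set V) :
    ℕ → ι → V
  | 0 => fun ω => nearPoint 1 0 (G 0 ω)
  | n + 1 => fun ω => nearPoint (1 / 2 ^ n) (nearSeq G n ω) (G (n + 1) ω)

lemma nearSeq_mem {ι : Type*} {V : Type*} [NormedAddCommGroup V] {G : ℕ → ι → Set V} {ω : ι}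
    (hG : ∀ n, (G n ω).Nonempty) (n : ℕ) :
    nearSeq G n ω ∈ G n ω := by
  cases n with
  | zero => exact (nearPoint_spec one_pos _ (hG 0)).1
  | succ n => exact (nearPoint_spec (by positivity) _ (hG (n + 1))).1

lemma countablyValued_nearSeq {V : Type*} [NormedAddCommGroup V] {G : ℕ → Ω → Set V}
    (hG : ∀ n, CountablyValued (G n)) (n : ℕ) :
    CountablyValued (nearSeq G n) := by
  induction n with
  | zero => exact (CountablyValued.const (0 : V)).map₂ (hG 0) (nearPoint 1)
  | succ n ih => exact ih.map₂ (hG (n + 1)) (nearPoint (1 / 2 ^ n))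

lemma infDist_nearSeq_le {ι : Type*} {V : Type*} [NormedAddCommGroup V]
    {G : ℕ → ι → Set V} {ω : ι} {A : Set V}
    (hG : ∀ n, IsCB (G n ω)) (h : ∀ n, hdist (G n ω) A ≤ 1 / 2 ^ n) (n : ℕ) :
    infDist (nearSeq G n ω) A ≤ 1 / 2 ^ n :=
  (infDist_le_excess (hG n) A (nearSeq_mem (fun k => (hG k).1) n)).trans
    ((le_max_left _ _).trans (h n))

lemma dist_nearSeq_succ_le {ι : Type*} {V : Type*} [NormedAddCommGroup V]
    {G : ℕ → ι → Set V} {ω : ι} {A : Set V} (hA : IsCB A)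
    (hG : ∀ n, IsCB (G n ω)) (h : ∀ n, hdist (G n ω) A ≤ 1 / 2 ^ n) (n : ℕ) :
    dist (nearSeq G n ω) (nearSeq G (n + 1) ω) ≤ 6 / 2 / 2 ^ n := by
  have h1 : dist (nearSeq G n ω) (nearSeq G (n + 1) ω)
      < infDist (nearSeq G n ω) (G (n + 1) ω) + 1 / 2 ^ n :=
    (nearPoint_spec (by positivity) _ (hG (n + 1)).1).2
  have h2 := infDist_le_infDist_add_excess hA (G (n + 1) ω) (nearSeq G n ω)
  have h3 := infDist_nearSeq_le hG h n
  have h4 : excess A (G (n + 1) ω) ≤ 1 / 2 ^ (n + 1) := (le_max_right _ _).trans (h (n + 1))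
  have h5 : (1 : ℝ) / 2 ^ (n + 1) ≤ 1 / 2 ^ n := by gcongr <;> norm_num
  have h6 : (6 : ℝ) / 2 / 2 ^ n = 3 * (1 / 2 ^ n) := by ring
  linarith

lemma exists_lim_nearSeq {ι : Type*} {V : Type*} [NormedAddCommGroup V] [CompleteSpace V]
    {G : ℕ → ι → Set V} {ω : ι} {A : Set V} (hA : IsCB A)
    (hG : ∀ n, IsCB (G n ω)) (h : ∀ n, hdist (G n ω) A ≤ 1 / 2 ^ n) :
    ∃ x ∈ A, Tendsto (fun n => nearSeq G n ω) atTop (𝓝 x) ∧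
      ∀ n, dist (nearSeq G n ω) x ≤ 6 / 2 ^ n := by
  have hd := dist_nearSeq_succ_le hA hG h
  obtain ⟨x, hx⟩ := cauchySeq_tendsto_of_complete (cauchySeq_of_le_geometric_two hd)
  refine ⟨x, ?_, hx, dist_le_of_le_geometric_two_of_tendsto hd hx⟩
  rw [hA.2.1.mem_iff_infDist_zero hA.1]
  have h0 : Tendsto (fun n : ℕ => (1 : ℝ) / 2 ^ n) atTop (𝓝 0) := by
    simpa [one_div, inv_pow] using
      tendsto_pow_atTop_nhds_zero_of_lt_one (r := (2⁻¹ : ℝ)) (by norm_num) (by norm_num)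
  exact le_antisymm
    (le_of_tendsto_of_tendsto' (((continuous_infDist_pt A).tendsto x).comp hx) h0
      (infDist_nearSeq_le hG h)) infDist_nonneg

/-- Theorem 5.1 (measurable selection in a possibly non-separable Banach space):
if `(Ω, 𝒜, P)` is a complete probability space, `F : Ω → ℭ(E)` is strongly measurable
and `∫ ‖F‖ dP < ∞`, then `F` admits a measurable selection, which is moreover Bochner
integrable. -/
theorem exists_measurable_selection (μ : Measure Ω) [IsProbabilityMeasure μ]
    [μ.IsComplete]
    (F : Ω → Set E) (hF : ∀ ω, IsCB (F ω)) (hFm : SMeasurableSet μ F)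
    (hFi : ∫⁻ ω, ENNReal.ofReal (sSup ((fun x => ‖x‖) '' F ω)) ∂μ < ⊤) :
    ∃ f : Ω → E, PMeasurable μ f ∧ (∀ᵐ ω ∂μ, f ω ∈ F ω) ∧ Integrable f μ := by
  obtain ⟨G, hGc, hGb, hGF⟩ := hFm
  choose N hN using fun k : ℕ => hGF (1 / 2 ^ k) (by positivity)
  have hlim : ∀ᵐ ω ∂μ, ∃ x ∈ F ω,
      Tendsto (fun n => nearSeq (fun k => G (N k)) n ω) atTop (𝓝 x) ∧
        ∀ n, dist (nearSeq (fun k => G (N k)) n ω) x ≤ 6 / 2 ^ n := by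
    filter_upwards [ae_all_iff.2 fun k => hN k (N k) le_rfl] with ω hω
    exact exists_lim_nearSeq (hF ω) (fun k => hGb (N k) ω) hω
  obtain ⟨f, hf⟩ : ∃ f : Ω → E, ∀ᵐ ω ∂μ, f ω ∈ F ω ∧
      Tendsto (fun n => nearSeq (fun k => G (N k)) n ω) atTop (𝓝 (f ω)) ∧
        ∀ n, dist (nearSeq (fun k => G (N k)) n ω) (f ω) ≤ 6 / 2 ^ n :=
    Filter.Eventually.choice hlim
  have hc := countablyValued_nearSeq fun k => hGc (N k)
  refine ⟨f, ⟨nearSeq fun k => G (N k), hc, fun ε hε => ?_⟩, hf.mono fun ω h => h.1, ?_, ?_⟩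
  · have h0 : Tendsto (fun n : ℕ => (6 : ℝ) / 2 ^ n) atTop (𝓝 0) :=
      tendsto_const_nhds.div_atTop (tendsto_pow_atTop_atTop_of_one_lt one_lt_two)
    obtain ⟨M, hM⟩ := eventually_atTop.1 (h0.eventually_le_const hε)
    refine ⟨M, fun n hn => hf.mono fun ω h => ?_⟩
    rw [← dist_eq_norm]
    exact (h.2.2 n).trans (hM n hn)
  · exact aestronglyMeasurable_of_tendsto_ae atTop
      (fun n => (hc n).stronglyMeasurable.aestronglyMeasurable) (hf.mono fun ω h => h.2.1)
  · refine (lintegral_mono_ae (hf.mono fun ω h => ?_)).trans_lt hFi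
    rw [← ofReal_norm]
    exact ENNReal.ofReal_le_ofReal <| le_csSup
      (lipschitzWith_one_norm.isBounded_image (hF ω).2.2).bddAbove ⟨f ω, h.1, rfl⟩
end

section
/- Let (Ω, 𝒜, P) be a complete probability space without atoms, E a real Banach space, Ω' ∈ 𝒜, and C ∈ ℭ_c(E). Then the Aumann integral of the constant set-valued map C over Ω' equals P(Ω')·C; that is, the closure of { ∫_{Ω'} σ dP : σ is a measurable selection of the constant map ω ↦ C, Bochner integrable } equals { P(Ω')·c : c ∈ C }. -/
open Metric Filter Topology MeasureTheory Pointwise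

variable {Ω : Type*} [MeasurableSpace Ω]
variable {E : Type*} [NormedAddCommGroup E] [NormedSpace ℝ E] [CompleteSpace E]

/-- A measure is atomless if every measurable set of positive measure contains a
measurable subset of strictly smaller positive measure. -/
def Atomless (μ : Measure Ω) : Prop :=
  ∀ A : Set Ω, MeasurableSet A → 0 < μ A →
    ∃ B ⊆ A, MeasurableSet B ∧ 0 < μ B ∧ μ B < μ A

theorem countablyValued_const {α : Type*} (c : α) : CountablyValued (fun _ : Ω => c) := by
  refine ⟨fun i => if i = 0 then Set.univ else ∅, fun _ => c, ?_, ?_, ?_, fun _ _ _ => rfl⟩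
  · intro i
    dsimp only
    split_ifs <;> simp
  · intro i j hij
    by_cases hi : i = 0
    · have hj : j ≠ 0 := fun hj => hij (hi.trans hj.symm)
      simp [Function.onFun, hj]
    · simp [Function.onFun, hi]
  · exact Set.eq_univ_of_forall fun ω => Set.mem_iUnion.2 ⟨0, by simp⟩

theorem pMeasurable_const {F : Type*} [NormedAddCommGroup F] (μ : Measure Ω) (c : F) :
    PMeasurable μ (fun _ : Ω => c) :=
  ⟨fun _ _ => c, fun _ => countablyValued_const c, fun ε hε =>
    ⟨0, fun _ _ => Eventually.of_forall fun _ => by simpa using hε.le⟩⟩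

/-- The integral over a set of an integrable function with values in a closed convex set `C`
lies in the dilation of `C` by the measure of that set. -/
theorem setIntegral_mem_smul_of_convex {F : Type*} [NormedAddCommGroup F] [NormedSpace ℝ F]
    [CompleteSpace F] {μ : Measure Ω} [IsFiniteMeasure μ] {s : Set Ω} {C : Set F}
    (hCne : C.Nonempty) (hCcl : IsClosed C) (hCcv : Convex ℝ C) {σ : Ω → F}
    (hσC : ∀ᵐ ω ∂μ, σ ω ∈ C) (hσ : IntegrableOn σ s μ) :
    ∫ ω in s, σ ω ∂μ ∈ (μ s).toReal • C := by
  by_cases h0 : μ s = 0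
  · simp [h0, Measure.restrict_eq_zero.2 h0, Set.zero_smul_set hCne]
  · refine ⟨⨍ ω in s, σ ω ∂μ, hCcv.set_average_mem hCcl h0 (measure_ne_top μ s)
      (ae_restrict_of_ae hσC) hσ, ?_⟩
    exact measure_smul_setAverage σ (measure_ne_top μ s)

/-- Proposition 5.3, first part: over a complete atomless probability space, the Aumann
integral of the constant set-valued map with value `C ∈ ℭ_c(E)` over `Ω' ∈ 𝒜` is
`P(Ω') • C`. -/
theorem aumann_integral_const_convex (μ : Measure Ω) [IsProbabilityMeasure μ]
    [μ.IsComplete] (hμa : Atomless μ)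
    (Ω' : Set Ω) (hΩ' : MeasurableSet Ω')
    (C : Set E) (hCne : C.Nonempty) (hCcl : IsClosed C)
    (hCbd : Bornology.IsBounded C) (hCcv : Convex ℝ C) :
    closure {x : E | ∃ σ : Ω → E, PMeasurable μ σ ∧ (∀ᵐ ω ∂μ, σ ω ∈ C) ∧
        IntegrableOn σ Ω' μ ∧ x = ∫ ω in Ω', σ ω ∂μ} =
      (μ Ω').toReal • C := by
  apply Set.Subset.antisymm
  · refine closure_minimal ?_ ?_
    · rintro x ⟨σ, -, hσC, hσ, rfl⟩
      exact setIntegral_mem_smul_of_convex hCne hCcl hCcv hσC hσ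
    · by_cases h0 : (μ Ω').toReal = 0
      · rw [h0, Set.zero_smul_set hCne]
        exact isClosed_singleton
      · exact hCcl.smul_of_ne_zero h0
  · rintro _ ⟨c, hc, rfl⟩
    refine subset_closure ⟨fun _ => c, pMeasurable_const μ c, Eventually.of_forall fun _ => hc,
      integrableOn_const (measure_ne_top μ Ω'), ?_⟩
    rw [setIntegral_const]
    rfl
end

section
/- Let (Ω, 𝒜, P) be a complete probability space without atoms, E a real Banach space, Ω' ∈ 𝒜, and C ∈ ℭ(E). Then the Aumann integral of the constant set-valued map C over Ω' equals P(Ω') times the closed convex hull of C; that is, the closure of { ∫_{Ω'} σ dP : σ is a Bochner-integrable measurable selection of the constant map ω ↦ C } equals { P(Ω')·x : x ∈ co̅C }, where co̅C is the closed convex hull of C. -/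
open Metric Filter Topology MeasureTheory Pointwise

variable {Ω : Type*} [MeasurableSpace Ω]
variable {E : Type*} [NormedAddCommGroup E] [NormedSpace ℝ E] [CompleteSpace E]

theorem Atomless.exists_subset_measureReal_le {μ : Measure Ω} [IsFiniteMeasure μ]
    (hμ : Atomless μ) {A : Set Ω} (hA : MeasurableSet A) (hA0 : 0 < μ.real A)
    {ε : ℝ} (hε : 0 < ε) :
    ∃ B ⊆ A, MeasurableSet B ∧ 0 < μ.real B ∧ μ.real B ≤ ε := by
  have halving : ∀ n : ℕ, ∃ B ⊆ A, MeasurableSet B ∧ 0 < μ.real B ∧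
      μ.real B ≤ μ.real A * (1 / 2) ^ n := by
    intro n
    induction n with
    | zero => exact ⟨A, subset_rfl, hA, hA0, by simp⟩
    | succ n ih =>
      obtain ⟨B, hBA, hB, hB0, hBn⟩ := ih
      obtain ⟨D, hDB, hD, hD0, hDlt⟩ := hμ B hB (ENNReal.toReal_pos_iff.mp hB0).1
      have hD0' : 0 < μ.real D := ENNReal.toReal_pos hD0.ne' (measure_ne_top μ D)
      have hDlt' : μ.real D < μ.real B :=
        (ENNReal.toReal_lt_toReal (measure_ne_top μ D) (measure_ne_top μ B)).mpr hDlt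
      have hdiff : μ.real (B \ D) = μ.real B - μ.real D := measureReal_sdiff hDB hD
      rcases le_total (μ.real D) (μ.real B / 2) with h | h
      · refine ⟨D, hDB.trans hBA, hD, hD0', ?_⟩
        rw [pow_succ]
        linarith
      · refine ⟨B \ D, Set.sdiff_subset.trans hBA, hB.diff hD, by linarith, ?_⟩
        rw [pow_succ]
        linarith
  obtain ⟨n, hn⟩ := exists_pow_lt_of_lt_one (div_pos hε hA0) (one_half_lt_one (α := ℝ))
  obtain ⟨B, hBA, hB, hB0, hBn⟩ := halving n
  refine ⟨B, hBA, hB, hB0, hBn.trans ?_⟩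
  rw [lt_div_iff₀ hA0] at hn
  linarith

/-- Sierpiński's theorem: a finite atomless measure takes on the measurable subsets of `A` every
value between `0` and the measure of `A`. -/
theorem Atomless.exists_subset_measureReal_eq {μ : Measure Ω} [IsFiniteMeasure μ]
    (hμ : Atomless μ) {A : Set Ω} (hA : MeasurableSet A) {t : ℝ} (ht0 : 0 ≤ t)
    (htA : t ≤ μ.real A) :
    ∃ B ⊆ A, MeasurableSet B ∧ μ.real B = t := by
  let S := {B : Set Ω // B ⊆ A ∧ MeasurableSet B ∧ μ.real B ≤ t}
  -- Each admissible set has an admissible enlargement gaining at least half of what is possible.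
  have enlarge : ∀ B : S, ∃ B' : S, B.1 ⊆ B'.1 ∧
      ∀ D : S, B.1 ⊆ D.1 → μ.real D.1 ≤ 2 * μ.real B'.1 - μ.real B.1 := by
    intro B
    by_cases hex : ∃ D : S, B.1 ⊆ D.1 ∧ μ.real B.1 < μ.real D.1
    · let V : Set ℝ := {r | ∃ D : S, B.1 ⊆ D.1 ∧ μ.real D.1 = r}
      have hbdd : BddAbove V := ⟨t, by rintro _ ⟨D, -, rfl⟩; exact D.2.2.2⟩
      obtain ⟨D₀, hBD₀, hlt⟩ := hex
      have hB : μ.real B.1 < sSup V := hlt.trans_le (le_csSup hbdd ⟨D₀, hBD₀, rfl⟩)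
      obtain ⟨_, ⟨B', hBB', rfl⟩, hB'⟩ := exists_lt_of_lt_csSup (s := V) ⟨_, B, subset_rfl, rfl⟩
        (show (μ.real B.1 + sSup V) / 2 < sSup V by linarith)
      refine ⟨B', hBB', fun D hBD ↦ ?_⟩
      have := le_csSup hbdd ⟨D, hBD, rfl⟩
      linarith
    · push Not at hex
      exact ⟨B, subset_rfl, fun D hD ↦ by linarith [hex D hD]⟩
  choose next hnext hmax using enlarge
  let u : ℕ → S := fun n ↦ next^[n] ⟨∅, Set.empty_subset A, .empty, by simpa using ht0⟩
  have hu : ∀ n, u (n + 1) = next (u n) := fun n ↦ Function.iterate_succ_apply' next n _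
  have hmono : Monotone fun n ↦ (u n).1 := monotone_nat_of_le_succ fun n ↦ by
    simpa only [hu] using hnext (u n)
  have htends : Tendsto (fun n ↦ μ.real (u n).1) atTop (𝓝 (μ.real (⋃ n, (u n).1))) :=
    (ENNReal.tendsto_toReal (measure_ne_top μ _)).comp (tendsto_measure_iUnion_atTop hmono)
  set U : Set Ω := ⋃ n, (u n).1
  have hUA : U ⊆ A := Set.iUnion_subset fun n ↦ (u n).2.1
  have hUm : MeasurableSet U := .iUnion fun n ↦ (u n).2.2.1
  have hUt : μ.real U ≤ t := le_of_tendsto' htends fun n ↦ (u n).2.2.2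
  refine ⟨U, hUA, hUm, hUt.antisymm ?_⟩
  by_contra! hlt
  have hdiff : μ.real (A \ U) = μ.real A - μ.real U := measureReal_sdiff hUA hUm
  obtain ⟨D, hDA, hD, hD0, hDt⟩ := hμ.exists_subset_measureReal_le (hA.diff hUm)
    (by linarith) (sub_pos.mpr hlt)
  have hunion : μ.real (U ∪ D) = μ.real U + μ.real D :=
    measureReal_union (Set.disjoint_left.mpr fun _ hx hxD ↦ (hDA hxD).2 hx) hD
  have hle : μ.real (U ∪ D) ≤ 2 * μ.real U - μ.real U := by
    refine ge_of_tendsto' (((htends.comp (tendsto_add_atTop_nat 1)).const_mul 2).sub htends)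
      fun n ↦ ?_
    have := hmax (u n) ⟨U ∪ D, Set.union_subset hUA (hDA.trans Set.sdiff_subset), hUm.union hD,
      by linarith⟩ ((Set.subset_iUnion (fun n ↦ (u n).1) n).trans Set.subset_union_left)
    simpa only [hu, Function.comp_apply] using this
  linarith

theorem MeasureTheory.SimpleFunc.countablyValued {α : Type*} [Nonempty α] (σ : SimpleFunc Ω α) :
    CountablyValued σ := by
  have : Countable (Set.range σ) := σ.finite_range.countable.to_subtype
  obtain ⟨e, he⟩ := exists_injective_nat (Set.range σ)
  refine ⟨fun i ↦ σ ⁻¹' {x | ∃ h : x ∈ Set.range σ, e ⟨x, h⟩ = i},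
    Function.extend e Subtype.val fun _ ↦ Classical.arbitrary α,
    fun i ↦ σ.measurableSet_preimage _, ?_, ?_, ?_⟩
  · refine fun i j hij ↦ Set.disjoint_left.mpr ?_
    rintro ω ⟨_, hi⟩ ⟨_, hj⟩
    exact hij (hi.symm.trans hj)
  · exact Set.eq_univ_of_forall fun ω ↦
      Set.mem_iUnion.mpr ⟨e ⟨σ ω, Set.mem_range_self ω⟩, Set.mem_range_self ω, rfl⟩
  · rintro _ ω ⟨h, rfl⟩
    exact (he.extend_apply Subtype.val _ ⟨σ ω, h⟩).symm

theorem CountablyValued.pMeasurable {F : Type*} [NormedAddCommGroup F] {f : Ω → F}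
    (hf : CountablyValued f) (μ : Measure Ω) :
    PMeasurable μ f :=
  ⟨fun _ ↦ f, fun _ ↦ hf, fun ε hε ↦ ⟨0, fun _ _ ↦ ae_of_all _ fun _ ↦ by simpa using hε.le⟩⟩

theorem Atomless.exists_simpleFunc_setIntegral_eq {μ : Measure Ω} [IsFiniteMeasure μ]
    (hμ : Atomless μ) {C : Set E} {x : E} (hx : x ∈ convexHull ℝ C) {A : Set Ω}
    (hA : MeasurableSet A) :
    ∃ σ : SimpleFunc Ω E, (∀ ω, σ ω ∈ C) ∧ ∫ ω in A, σ ω ∂μ = μ.real A • x := by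
  let T : Set E := {x | ∀ A, MeasurableSet A →
    ∃ σ : SimpleFunc Ω E, (∀ ω, σ ω ∈ C) ∧ ∫ ω in A, σ ω ∂μ = μ.real A • x}
  suffices h : convexHull ℝ C ⊆ T from h hx A hA
  refine convexHull_min (fun c hc A hA ↦ ⟨SimpleFunc.const Ω c, fun _ ↦ hc, by simp⟩) ?_
  intro x hx y hy a b ha hb hab A hA
  obtain ⟨B, hBA, hB, hBa⟩ := hμ.exists_subset_measureReal_eq hA
    (mul_nonneg ha measureReal_nonneg)
    (mul_le_of_le_one_left measureReal_nonneg (by linarith : a ≤ 1))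
  obtain ⟨σ, hσC, hσ⟩ := hx B hB
  obtain ⟨τ, hτC, hτ⟩ := hy (A \ B) (hA.diff hB)
  refine ⟨σ.piecewise B hB τ, fun ω ↦ ?_, ?_⟩
  · by_cases hω : ω ∈ B <;> simp [SimpleFunc.piecewise_apply, hω, hσC, hτC]
  · have hint : IntegrableOn (σ.piecewise B hB τ) A μ :=
      (SimpleFunc.integrable_of_isFiniteMeasure _).integrableOn
    have hdiff : μ.real (A \ B) = b * μ.real A := by
      rw [measureReal_sdiff hBA hB, hBa, eq_sub_of_add_eq' hab]
      ring
    have h₁ : ∫ ω in B, σ.piecewise B hB τ ω ∂μ = ∫ ω in B, σ ω ∂μ :=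
      setIntegral_congr_fun hB fun ω hω ↦ by simp [SimpleFunc.piecewise_apply, hω]
    have h₂ : ∫ ω in A \ B, σ.piecewise B hB τ ω ∂μ = ∫ ω in A \ B, τ ω ∂μ :=
      setIntegral_congr_fun (hA.diff hB) fun ω hω ↦ by simp [SimpleFunc.piecewise_apply, hω.2]
    rw [← integral_inter_add_sdiff hB hint, Set.inter_eq_right.mpr hBA, h₁, h₂, hσ, hτ, hBa, hdiff]
    module

/-- Proposition 5.3, second part: over a complete atomless probability space, the Aumann
integral of the constant set-valued map with value `C ∈ ℭ(E)` over `Ω' ∈ 𝒜` equals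
`P(Ω')` times the closed convex hull of `C`. -/
theorem aumann_integral_const (μ : Measure Ω) [IsProbabilityMeasure μ]
    [μ.IsComplete] (hμa : Atomless μ)
    (Ω' : Set Ω) (hΩ' : MeasurableSet Ω')
    (C : Set E) (hCne : C.Nonempty) (hCcl : IsClosed C)
    (hCbd : Bornology.IsBounded C) :
    closure {x : E | ∃ σ : Ω → E, PMeasurable μ σ ∧ (∀ᵐ ω ∂μ, σ ω ∈ C) ∧
        IntegrableOn σ Ω' μ ∧ x = ∫ ω in Ω', σ ω ∂μ} =
      (μ Ω').toReal • closure (convexHull ℝ C) := by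
  apply Set.Subset.antisymm
  · refine closure_minimal ?_ (isClosed_closure.smul₀ _)
    rintro _ ⟨σ, -, hσC, hσi, rfl⟩
    rcases eq_or_ne (μ Ω') 0 with h0 | h0
    · obtain ⟨c, hc⟩ := hCne
      exact ⟨c, subset_closure (subset_convexHull ℝ C hc), by
        simp [h0, Measure.restrict_eq_zero.mpr h0]⟩
    · refine ⟨⨍ ω in Ω', σ ω ∂μ, (convex_convexHull ℝ C).set_average_mem_closure h0
        (measure_ne_top μ Ω') ?_ hσi, measure_smul_setAverage σ (measure_ne_top μ Ω')⟩
      exact ae_restrict_of_ae (hσC.mono fun ω hω ↦ subset_convexHull ℝ C hω)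
  · refine (image_closure_subset_closure_image (continuous_const_smul _)).trans
      (closure_mono ?_)
    rintro _ ⟨x, hx, rfl⟩
    obtain ⟨σ, hσC, hσ⟩ := hμa.exists_simpleFunc_setIntegral_eq hx hΩ'
    exact ⟨σ, σ.countablyValued.pMeasurable μ, ae_of_all _ hσC,
      (SimpleFunc.integrable_of_isFiniteMeasure σ).integrableOn, hσ.symm⟩
end
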